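/- arXiv:2409.05039 — 2 statements merged into one kernel-verified Lean document; each statement's English description precedes it below -/
import Mathlib

section
/- For every integer k ≥ 0, if G is an acyclic digraph with exactly one source, then there exists a set X of vertices with (k+1)·(|X| − 1) ≤ |V(G)| − 1 (equivalently |X| ≤ 1 + (|V(G)|−1)/(k+1)) that k-covers V(G); moreover, either |V(G)| = 1, or (k+1)·(|X| − 1) ≤ |V(G)| − 2, or X is not stable. -/
/-- There is a directed path (walk) of length at most `k` from `x` to `y`
in the digraph with adjacency relation `E`. -/
def ReachesIn {V : Type*} (E : V → V → Prop) : ℕ → V → V → Prop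
  | 0, x, y => x = y
  | k + 1, x, y => x = y ∨ ∃ z, E x z ∧ ReachesIn E k z y

/-- `X` k-covers `Y`: every vertex of `Y` is joined from some vertex of `X`
by a directed path of length at most `k`. -/
def KCovers {V : Type*} (E : V → V → Prop) (k : ℕ) (X Y : Set V) : Prop :=
  ∀ y ∈ Y, ∃ x ∈ X, ReachesIn E k x y

/-- `X` is a stable set: no edge has both ends in `X`. -/
def StableSet {V : Type*} (E : V → V → Prop) (X : Set V) : Prop :=
  ∀ x ∈ X, ∀ y ∈ X, ¬ E x y

/-- A `k`-kernel: a stable set that k-covers the whole vertex set. -/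
def IsKernel {V : Type*} (E : V → V → Prop) (k : ℕ) (X : Set V) : Prop :=
  StableSet E X ∧ KCovers E k X Set.univ

/-- A source: a vertex of in-degree zero. -/
def IsSource {V : Type*} (E : V → V → Prop) (v : V) : Prop := ∀ u, ¬ E u v

/-- An oriented graph: no loops and no directed cycles of length two. -/
def Oriented {V : Type*} (E : V → V → Prop) : Prop :=
  (∀ v, ¬ E v v) ∧ ∀ u v, E u v → ¬ E v u

/-- The induced subdigraph on a set `S` of vertices. -/
def Induce {V : Type*} (E : V → V → Prop) (S : Set V) : V → V → Prop :=
  fun a b => a ∈ S ∧ b ∈ S ∧ E a b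

/-- `E` induces a tournament on `T`: any two distinct vertices of `T` are
joined by exactly one directed edge. -/
def IsTournamentOn {V : Type*} (E : V → V → Prop) (T : Set V) : Prop :=
  ∀ u ∈ T, ∀ v ∈ T, u ≠ v → (E u v ∨ E v u) ∧ ¬ (E u v ∧ E v u)

/-- The relation `E` is acyclic: there is no directed cycle. -/
def AcyclicRel {V : Type*} (E : V → V → Prop) : Prop :=
  ∀ x y, E x y → ¬ Relation.ReflTransGen E y x

/-- A split of an oriented graph: a partition `(S,T)` of the vertex set
where `S` is stable and `T` induces a tournament. -/
def IsSplit {V : Type*} (E : V → V → Prop) (S T : Set V) : Prop :=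
  S ∪ T = Set.univ ∧ Disjoint S T ∧ StableSet E S ∧ IsTournamentOn E T

/-- A break of an oriented graph: a partition `(S,T)` of the vertex set
where `S` induces an acyclic digraph and `T` induces a tournament. -/
def IsBreak {V : Type*} (E : V → V → Prop) (S T : Set V) : Prop :=
  S ∪ T = Set.univ ∧ Disjoint S T ∧ AcyclicRel (Induce E S) ∧ IsTournamentOn E T

/-- `N⁺_G[X]`: the set of vertices that belong to `X` or have an in-neighbour in `X`. -/
def ClosedOut {V : Type*} (E : V → V → Prop) (X : Set V) : Set V :=
  {v | v ∈ X ∨ ∃ x ∈ X, E x v}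

/-- Extending the length bound keeps a vertex reachable. -/
theorem ReachesIn.mono {V : Type*} {E : V → V → Prop} {j k : ℕ} (hjk : j ≤ k) {x y : V}
    (h : ReachesIn E j x y) : ReachesIn E k x y := by
  induction j generalizing k x with
  | zero =>
    cases k with
    | zero => exact h
    | succ k => exact Or.inl h
  | succ j ih =>
    obtain ⟨k, rfl⟩ : ∃ m, k = m + 1 := ⟨k - 1, by omega⟩
    rcases h with h | ⟨z, hxz, hzy⟩
    · exact Or.inl h
    · exact Or.inr ⟨z, hxz, ih (by omega) hzy⟩

/-- A finite acyclic relation is well-founded. -/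
theorem AcyclicRel.wellFounded {V : Type*} [Finite V] {E : V → V → Prop} (hac : AcyclicRel E) :
    WellFounded E := by
  have : Std.Irrefl (Relation.TransGen E) := ⟨fun v hv => by
    obtain ⟨w, hvw, hwv⟩ := Relation.TransGen.head'_iff.1 hv
    exact hac v w hvw hwv⟩
  exact Subrelation.wf (fun h => Relation.TransGen.single h)
    (Finite.wellFounded_of_trans_of_irrefl (Relation.TransGen E))

/-- A well-founded digraph has a depth function: it vanishes at sources, and every other vertex
has an in-neighbour which is one level higher. -/
theorem WellFounded.exists_depth {V : Type*} {E : V → V → Prop} (hwf : WellFounded E) :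
    ∃ d : V → ℕ, (∀ v, IsSource E v → d v = 0) ∧
      ∀ v, ¬ IsSource E v → ∃ u, E u v ∧ d v = d u + 1 := by
  classical
  have hp : ∀ v, ∃ u, ¬ IsSource E v → E u v := fun v => by
    by_cases h : IsSource E v
    · exact ⟨v, fun h' => absurd h h'⟩
    · simp only [IsSource, not_forall, not_not] at h
      exact ⟨h.choose, fun _ => h.choose_spec⟩
  choose p hp using hp
  let F : ∀ v, (∀ u, E u v → ℕ) → ℕ := fun v ih =>
    if h : IsSource E v then 0 else ih (p v) (hp v h) + 1
  refine ⟨hwf.fix F, fun v hv => ?_, fun v hv => ⟨p v, hp v hv, ?_⟩⟩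
  · rw [hwf.fix_eq]
    simp [F, hv]
  · rw [hwf.fix_eq]
    simp [F, hv]

/-- Climbing `j` levels of a depth function. -/
theorem exists_reachesIn_of_le_depth {V : Type*} {E : V → V → Prop} {d : V → ℕ}
    (h0 : ∀ v, IsSource E v → d v = 0)
    (h1 : ∀ v, ¬ IsSource E v → ∃ u, E u v ∧ d v = d u + 1) (v : V) (j : ℕ) (hj : j ≤ d v) :
    ∃ u, d u + j = d v ∧ ReachesIn E j u v := by
  induction j with
  | zero => exact ⟨v, rfl, rfl⟩
  | succ j ih =>
    obtain ⟨u, hu, huv⟩ := ih (by omega)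
    obtain ⟨w, hwu, hw⟩ := h1 u fun hs => by
      have := h0 u hs
      omega
    exact ⟨w, by omega, Or.inr ⟨u, hwu, huv⟩⟩

/-- A set containing all vertices of depth zero and all vertices whose depth lies in a fixed
residue class modulo `k + 1` is a `k`-cover. -/
theorem kCovers_of_depth_mod {V : Type*} {E : V → V → Prop} {d : V → ℕ}
    (h0 : ∀ v, IsSource E v → d v = 0)
    (h1 : ∀ v, ¬ IsSource E v → ∃ u, E u v ∧ d v = d u + 1) {k i : ℕ} (hi : i < k + 1)
    {X : Set V} (hX0 : ∀ v, d v = 0 → v ∈ X) (hXi : ∀ v, d v % (k + 1) = i → v ∈ X) :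
    KCovers E k X Set.univ := by
  intro y _
  rcases le_or_gt (d y) k with hy | hy
  · obtain ⟨u, hu, huy⟩ := exists_reachesIn_of_le_depth h0 h1 y (d y) le_rfl
    exact ⟨u, hX0 u (by omega), huy.mono hy⟩
  · have hlt : (d y - i) % (k + 1) < k + 1 := Nat.mod_lt _ k.succ_pos
    have hdiv := Nat.mod_add_div (d y - i) (k + 1)
    obtain ⟨u, hu, huy⟩ :=
      exists_reachesIn_of_le_depth h0 h1 y ((d y - i) % (k + 1)) (by omega)
    refine ⟨u, hXi u ?_, huy.mono (by omega)⟩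
    have : d u = i + (k + 1) * ((d y - i) / (k + 1)) := by omega
    rw [this, Nat.add_mul_mod_self_left, Nat.mod_eq_of_lt hi]

/-- For all $k \ge 0$: an acyclic digraph with exactly one source has a set $X$
that $k$-covers all vertices with $(k+1)(|X|-1) \le |G|-1$; moreover $|G|=1$, or
$(k+1)(|X|-1) \le |G|-2$, or $X$ is not stable. -/
theorem stmt_8 {V : Type*} [Fintype V] (E : V → V → Prop) (k : ℕ)
    (hirr : ∀ v, ¬ E v v) (hac : AcyclicRel E)
    (hsrc : ∃! r : V, IsSource E r) :
    ∃ X : Finset V, KCovers E k (↑X : Set V) Set.univ ∧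
      ((k : ℤ) + 1) * ((X.card : ℤ) - 1) ≤ (Fintype.card V : ℤ) - 1 ∧
      (Fintype.card V = 1 ∨
        ((k : ℤ) + 1) * ((X.card : ℤ) - 1) ≤ (Fintype.card V : ℤ) - 2 ∨
        ¬ StableSet E (↑X : Set V)) := by
  classical
  obtain ⟨r, hr, hr'⟩ := hsrc
  obtain ⟨d, h0, h1⟩ := hac.wellFounded.exists_depth
  have hd0 : ∀ v, d v = 0 → v = r := fun v hv => hr' v <| by
    by_contra hs
    obtain ⟨u, -, hu⟩ := h1 v hs
    omega
  let C : ℕ → Finset V := fun i => (Finset.univ.erase r).filter fun v => d v % (k + 1) = i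
  have hcard : ∀ i, (insert r (C i)).card = (C i).card + 1 := fun i =>
    Finset.card_insert_of_notMem (by simp [C])
  have hcov : ∀ i < k + 1, KCovers E k (↑(insert r (C i)) : Set V) Set.univ := fun i hi =>
    kCovers_of_depth_mod h0 h1 hi (fun v hv => by simp [hd0 v hv]) fun v hv => by
      by_cases hvr : v = r <;> simp [C, hvr, hv]
  have hpos : 0 < Fintype.card V := Fintype.card_pos_iff.2 ⟨r⟩
  have hsum : ∑ i ∈ Finset.range (k + 1), (C i).card = Fintype.card V - 1 := by
    rw [← Finset.card_univ, ← Finset.card_erase_of_mem (Finset.mem_univ r)]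
    exact (Finset.card_eq_sum_card_fiberwise fun v _ => by
      simpa using Nat.mod_lt (d v) k.succ_pos).symm
  by_cases hsmall : ∃ i < k + 1, (k + 1) * (C i).card + 2 ≤ Fintype.card V
  · obtain ⟨i, hi, hle⟩ := hsmall
    have hle' : ((k : ℤ) + 1) * (C i).card + 2 ≤ Fintype.card V := by exact_mod_cast hle
    refine ⟨insert r (C i), hcov i hi, ?_, Or.inr (Or.inl ?_)⟩ <;>
      rw [hcard] <;> push_cast <;> rw [add_sub_cancel_right] <;> linarith
  push Not at hsmall
  have hi : 1 % (k + 1) < k + 1 := Nat.mod_lt _ k.succ_pos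
  have heq : (k + 1) * (C (1 % (k + 1))).card = Fintype.card V - 1 := by
    have hge : ∀ i ∈ Finset.range (k + 1), Fintype.card V - 1 ≤ (k + 1) * (C i).card :=
      fun i hi => by
        have := hsmall i (Finset.mem_range.1 hi)
        omega
    have hsum' : ∑ i ∈ Finset.range (k + 1), (Fintype.card V - 1) =
        ∑ i ∈ Finset.range (k + 1), (k + 1) * (C i).card := by
      rw [← Finset.mul_sum, hsum]
      simp
    exact ((Finset.sum_eq_sum_iff_of_le hge).1 hsum' _ (Finset.mem_range.2 hi)).symm
  have heq' : ((k : ℤ) + 1) * (C (1 % (k + 1))).card = Fintype.card V - 1 := by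
    zify [Nat.one_le_iff_ne_zero.2 hpos.ne'] at heq
    exact_mod_cast heq
  refine ⟨insert r (C (1 % (k + 1))), hcov _ hi, ?_, ?_⟩
  · rw [hcard]
    push_cast
    rw [add_sub_cancel_right]
    exact_mod_cast heq'.le
  by_cases hV : Fintype.card V = 1
  · exact Or.inl hV
  refine Or.inr (Or.inr fun hst => ?_)
  obtain ⟨v, hv⟩ := Fintype.exists_ne_of_one_lt_card (by omega) r
  have hdv : d v ≠ 0 := fun h => hv (hd0 v h)
  obtain ⟨u, hu, -⟩ := exists_reachesIn_of_le_depth h0 h1 v (d v - 1) (by omega)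
  have hu1 : d u = 1 := by omega
  have hur : u ≠ r := fun h => by
    rw [h, h0 r hr] at hu1
    omega
  obtain ⟨w, hwu, hw⟩ := h1 u fun hs => hur (hr' u hs)
  rw [hd0 w (by omega)] at hwu
  exact hst r (by simp) u (by simp [C, hur, hu1]) hwu
end

section
/- Suppose that every digraph H with no source has a 2-kernel of size at most |V(H)|/2. Then for every digraph G and every map f : V(G) → ℕ, there is a 2-kernel K of G with 2·f(N⁺_G[K]) ≥ f(V(G)), where f(X) denotes the sum of f(v) over v ∈ X. -/
universe u

theorem reachesIn_two_iff {V : Type*} {E : V → V → Prop} {x y : V} :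
    ReachesIn E 2 x y ↔ x = y ∨ ∃ z, E x z ∧ (z = y ∨ E z y) := by
  simp only [ReachesIn]
  constructor
  · rintro (h | ⟨z, hz, h | ⟨w, hw, rfl⟩⟩)
    · exact .inl h
    · exact .inr ⟨z, hz, .inl h⟩
    · exact .inr ⟨z, hz, .inr hw⟩
  · rintro (h | ⟨z, hz, h | h⟩)
    · exact .inl h
    · exact .inr ⟨z, hz, .inl h⟩
    · exact .inr ⟨z, hz, .inr ⟨y, h, rfl⟩⟩

/-- The digraph obtained from `E` by attaching to every vertex `v` a set of
pendant out-neighbours indexed by `L v`. -/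
def AttachLeaves {V : Type*} (E : V → V → Prop) (L : V → Type*) :
    V ⊕ (Σ v, L v) → V ⊕ (Σ v, L v) → Prop
  | .inl u, .inl v => E u v
  | .inl u, .inr l => u = l.1
  | .inr _, _ => False

/-- A 2-kernel of a digraph with pendant out-neighbours attached restricts to a
2-kernel of the original digraph. -/
theorem IsKernel.preimage_inl_of_attachLeaves {V : Type*} {E : V → V → Prop}
    {L : V → Type*} {K : Set (V ⊕ (Σ v, L v))} (hK : IsKernel (AttachLeaves E L) 2 K) :
    IsKernel E 2 (Sum.inl ⁻¹' K) := by
  refine ⟨fun x hx y hy => hK.1 _ hx _ hy, fun y _ => ?_⟩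
  obtain ⟨x, hx, hr⟩ := hK.2 (.inl y) trivial
  rw [reachesIn_two_iff] at hr
  rcases hr with rfl | ⟨z, hxz, hz⟩
  · exact ⟨y, hx, reachesIn_two_iff.2 (.inl rfl)⟩
  · rcases x with x | x
    · refine ⟨x, hx, reachesIn_two_iff.2 ?_⟩
      rcases hz with rfl | hz
      · exact .inr ⟨y, hxz, .inl rfl⟩
      · rcases z with z | z
        · exact .inr ⟨z, hxz, .inr hz⟩
        · exact hz.elim
    · exact hxz.elim

/-- A 2-kernel contains every pendant vertex attached to a vertex outside the closed
out-neighbourhood of the kernel. -/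
theorem IsKernel.inr_mem_of_notMem_closedOut {V : Type*} {E : V → V → Prop}
    {L : V → Type*} {K : Set (V ⊕ (Σ v, L v))} (hK : IsKernel (AttachLeaves E L) 2 K)
    {l : Σ v, L v} (hl : l.1 ∉ ClosedOut E (Sum.inl ⁻¹' K)) : .inr l ∈ K := by
  obtain ⟨x, hx, hr⟩ := hK.2 (.inr l) trivial
  rw [reachesIn_two_iff] at hr
  rcases hr with rfl | ⟨z, hxz, hz⟩
  · exact hx
  · rcases x with x | x
    · refine (hl ?_).elim
      rcases hz with rfl | hz
      · have hxl : x = l.1 := hxz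
        exact .inl (hxl ▸ hx)
      · rcases z with z | z
        · have hzl : z = l.1 := hz
          exact .inr ⟨x, hx, hzl ▸ hxz⟩
        · exact hz.elim
    · exact hxz.elim

/-- If `E` restricted to the complement of the closed out-neighbourhood of the set of
sources has a 2-kernel `K`, then adding all sources to `K` gives a 2-kernel of `E`. -/
theorem IsKernel.sources_union {V : Type*} {E : V → V → Prop}
    {K : Set ↥(ClosedOut E {v | IsSource E v})ᶜ}
    (hK : IsKernel (fun a b : ↥(ClosedOut E {v | IsSource E v})ᶜ => E a b) 2 K) :
    IsKernel E 2 ({v | IsSource E v} ∪ Subtype.val '' K) := by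
  constructor
  · rintro x hx y (hy | ⟨y, hy, rfl⟩) hxy
    · exact hy x hxy
    · rcases hx with hx | ⟨x, hx, rfl⟩
      · exact y.2 (.inr ⟨x, hx, hxy⟩)
      · exact hK.1 x hx y hy hxy
  · intro y _
    by_cases hy : y ∈ ClosedOut E {v | IsSource E v}
    · rcases hy with hy | ⟨x, hx, hxy⟩
      · exact ⟨y, .inl hy, reachesIn_two_iff.2 (.inl rfl)⟩
      · exact ⟨x, .inl hx, reachesIn_two_iff.2 (.inr ⟨y, hxy, .inl rfl⟩)⟩
    · obtain ⟨x, hx, hr⟩ := hK.2 ⟨y, hy⟩ trivial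
      refine ⟨x, .inr ⟨x, hx, rfl⟩, reachesIn_two_iff.2 ?_⟩
      rcases reachesIn_two_iff.1 hr with rfl | ⟨z, hxz, rfl | hz⟩
      · exact .inl rfl
      · exact .inr ⟨y, hxz, .inl rfl⟩
      · exact .inr ⟨z, hxz, .inr hz⟩

open Classical in
/-- The source-free case: apply the bound on small 2-kernels after attaching to each
vertex `v` a number of pendant vertices proportional to `f v`. -/
theorem exists_kernel_of_no_source
    (hyp : ∀ (W : Type u) [Fintype W] (F : W → W → Prop), (∀ w, ¬ F w w) →
      (∀ w : W, ¬ IsSource F w) →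
      ∃ K : Finset W, IsKernel F 2 (↑K : Set W) ∧ 2 * K.card ≤ Fintype.card W)
    {V : Type u} [Fintype V] (E : V → V → Prop) (hirr : ∀ v, ¬ E v v)
    (hsrc : ∀ v, ¬ IsSource E v) (f : V → ℕ) :
    ∃ K : Set V, IsKernel E 2 K ∧ 2 * ∑ v with v ∉ ClosedOut E K, f v ≤ ∑ v, f v := by
  set M := Fintype.card V + 1 with hM
  obtain ⟨K, hK, hcard⟩ := hyp (V ⊕ (Σ v, Fin (M * f v)))
    (AttachLeaves E fun v => Fin (M * f v))
    (by rintro (v | l) h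
        · exact hirr v h
        · exact h)
    (by rintro (v | l) h
        · exact hsrc v fun u hu => h (.inl u) hu
        · exact h (.inl l.1) rfl)
  refine ⟨_, hK.preimage_inl_of_attachLeaves, ?_⟩
  set B : Finset V := {v | v ∉ ClosedOut E (Sum.inl ⁻¹' (K : Set (V ⊕ (Σ v, Fin (M * f v)))))}
    with hB
  have hsub : (B.sigma fun v => (Finset.univ : Finset (Fin (M * f v)))).map
      Function.Embedding.inr ⊆ K := by
    intro x hx
    obtain ⟨l, hl, rfl⟩ := Finset.mem_map.1 hx
    have hl' := (Finset.mem_sigma.1 hl).1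
    rw [hB, Finset.mem_filter] at hl'
    exact Finset.mem_coe.1 (hK.inr_mem_of_notMem_closedOut hl'.2)
  have hle := Finset.card_le_card hsub
  simp only [Finset.card_map, Finset.card_sigma, Finset.card_univ, Fintype.card_fin,
    ← Finset.mul_sum] at hle
  simp only [Fintype.card_sum, Fintype.card_sigma, Fintype.card_fin, ← Finset.mul_sum] at hcard
  have hlt : M * (2 * ∑ v ∈ B, f v) < M * (∑ v, f v + 1) := by
    rw [mul_left_comm, mul_add, mul_one]
    omega
  exact Nat.lt_succ_iff.1 (Nat.lt_of_mul_lt_mul_left hlt)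

open Classical in
/-- Under the hypothesis on small 2-kernels, some 2-kernel misses at most half of the total
weight with its closed out-neighbourhood. -/
theorem exists_kernel_two_mul_sum_compl_le
    (hyp : ∀ (W : Type u) [Fintype W] (F : W → W → Prop), (∀ w, ¬ F w w) →
      (∀ w : W, ¬ IsSource F w) →
      ∃ K : Finset W, IsKernel F 2 (↑K : Set W) ∧ 2 * K.card ≤ Fintype.card W)
    {V : Type u} [Fintype V] (E : V → V → Prop) (hirr : ∀ v, ¬ E v v) (f : V → ℕ) :
    ∃ K : Set V, IsKernel E 2 K ∧ 2 * ∑ v with v ∉ ClosedOut E K, f v ≤ ∑ v, f v := by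
  induction hn : Fintype.card V using Nat.strong_induction_on generalizing V with
  | _ n ih =>
  by_cases hsrc : ∀ v, ¬ IsSource E v
  · exact exists_kernel_of_no_source hyp E hirr hsrc f
  push Not at hsrc
  obtain ⟨s, hs⟩ := hsrc
  obtain ⟨K, hK, hle⟩ := ih _
    (hn ▸ Fintype.card_subtype_lt (x := s) fun h => h (.inl hs))
    (fun a b : ↥(ClosedOut E {v | IsSource E v})ᶜ => E a b) (fun v => hirr v)
    (fun v => f v) rfl
  refine ⟨_, hK.sources_union, ?_⟩
  have hsub : ({v | v ∉ ClosedOut E ({v | IsSource E v} ∪ Subtype.val '' K)} : Finset V) ⊆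
      ({w | w ∉ ClosedOut (fun a b : ↥(ClosedOut E {v | IsSource E v})ᶜ => E a b) K} :
        Finset _).map (Function.Embedding.subtype _) := by
    intro v hv
    rw [Finset.mem_filter] at hv
    have hv' : v ∈ (ClosedOut E {v | IsSource E v})ᶜ := by
      rintro (h | ⟨x, hx, h⟩)
      · exact hv.2 (.inl (.inl h))
      · exact hv.2 (.inr ⟨x, .inl hx, h⟩)
    refine Finset.mem_map.2 ⟨⟨v, hv'⟩, Finset.mem_filter.2 ⟨Finset.mem_univ _, ?_⟩, rfl⟩
    rintro (h | ⟨x, hx, h⟩)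
    · exact hv.2 (.inl (.inr ⟨_, h, rfl⟩))
    · exact hv.2 (.inr ⟨x, .inr ⟨x, hx, rfl⟩, h⟩)
  calc _ ≤ 2 * ∑ v ∈ Finset.map (Function.Embedding.subtype _) _, f v :=
        Nat.mul_le_mul_left 2 (Finset.sum_le_sum_of_subset hsub)
    _ ≤ ∑ w : ↥(ClosedOut E {v | IsSource E v})ᶜ, f w := by
        rw [Finset.sum_map]
        exact hle
    _ = ∑ v ∈ Finset.map (Function.Embedding.subtype _) Finset.univ, f v := by
        rw [Finset.sum_map]
        rfl
    _ ≤ ∑ v, f v := Finset.sum_le_sum_of_subset (Finset.subset_univ _)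

/-- If every digraph with no source has a 2-kernel of size at most half its number
of vertices, then in every digraph $G$, for every $f : V(G) → ℕ$, there is a
2-kernel $K$ with $2 f(N^+[K]) \ge f(V(G))$. -/
theorem stmt_13
    (hyp : ∀ (W : Type u) [Fintype W] (F : W → W → Prop), (∀ w, ¬ F w w) →
      (∀ w : W, ¬ IsSource F w) →
      ∃ K : Finset W, IsKernel F 2 (↑K : Set W) ∧ 2 * K.card ≤ Fintype.card W)
    {V : Type u} [Fintype V] (E : V → V → Prop) (hirr : ∀ v, ¬ E v v)
    (f : V → ℕ) :
    ∃ K : Set V, IsKernel E 2 K ∧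
      (∑ᶠ v : V, f v) ≤ 2 * ∑ᶠ v ∈ ClosedOut E K, f v := by
  classical
  obtain ⟨K, hK, hle⟩ := exists_kernel_two_mul_sum_compl_le hyp E hirr f
  refine ⟨K, hK, ?_⟩
  have hclosed : ∑ᶠ v ∈ ClosedOut E K, f v = ∑ v with v ∈ ClosedOut E K, f v := by
    rw [← finsum_mem_coe_finset]
    simp
  have hsplit := Finset.sum_filter_add_sum_filter_not Finset.univ (· ∈ ClosedOut E K) f
  rw [finsum_eq_sum_of_fintype, hclosed]
  omega
end
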